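/- Let {x₀¹,…,x₀ᴺ} ⊂ ℝ^d, α ∈ (0,1), σ² = 1 − α, and let A = diag(a₁,…,a_d) be a diagonal matrix. Define the binary mask B = diag(b₁,…,b_d) with b_j = 1 if a_j ≠ 0 and b_j = 0 otherwise. Then the minimizer, over measurable g : ℝ^d → ℝ with g(x) = g(Ax) for all x, of E_{i ~ Unif([N]), ε ~ N(0,I)} |g(√α x₀ⁱ + σε) − (x₀ⁱ)^q|² equals ĝ(x) = Σᵢ (x₀ⁱ)^q · softmaxᵢ{ −‖B(x − √α x₀ʲ)‖²/(2σ²) }_{j∈[N]}; in particular the constrained optimal denoiser depends only on the support of the diagonal of A, not on its nonzero values. -/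

import Mathlib

/-!
STATEMENT 8: For a diagonal matrix `A = diag(a₁,…,a_d)` and the binary mask
`B = diag(b₁,…,b_d)` with `b_j = 1` iff `a_j ≠ 0`, the minimizer over measurable
`g : ℝᵈ → ℝ` with `g(x) = g(Ax)` (i.e. `g` factors through `A`) of
`E_{i ~ Unif([N]), ε ~ N(0,I)} |g(√α x₀ⁱ + σε) − (x₀ⁱ)^q|²` is
`ĝ(x) = Σᵢ (x₀ⁱ)^q · softmaxᵢ{−‖B(x − √α x₀ʲ)‖²/(2σ²)}`; in particular the
constrained optimal denoiser depends only on the support of the diagonal of `A`.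
-/

open MeasureTheory ProbabilityTheory Real Filter Matrix
open scoped ENNReal

/-- Standard Gaussian `N(0, I)` on `ℝᵈ`. -/
noncomputable def stdGaussian (d : ℕ) : Measure (Fin d → ℝ) :=
  Measure.pi fun _ => gaussianReal 0 1

/-- Squared Euclidean norm `‖v‖² = ∑ q, (v q)²`. -/
noncomputable def sqnorm {d : ℕ} (v : Fin d → ℝ) : ℝ := ∑ q, (v q) ^ 2

/-- The binary mask `B = diag(b)` with `b_j = 1` if `a_j ≠ 0` and `b_j = 0` otherwise. -/
noncomputable def binaryMask {d : ℕ} (a : Fin d → ℝ) : Matrix (Fin d) (Fin d) ℝ :=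
  Matrix.diagonal fun j => if a j = 0 then 0 else 1

/-- The masked per-pixel optimal denoiser
`ĝ(x) = Σᵢ (x₀ⁱ)^q · softmaxᵢ{−‖B(x − √α x₀ʲ)‖²/(2σ²)}_{j∈[N]}`. -/
noncomputable def maskDenoiser {d N : ℕ} (x0 : Fin N → Fin d → ℝ) (α σ : ℝ)
    (q : Fin d) (B : Matrix (Fin d) (Fin d) ℝ) (x : Fin d → ℝ) : ℝ :=
  ∑ i, x0 i q *
    (Real.exp (-sqnorm (B.mulVec (x - Real.sqrt α • x0 i)) / (2 * σ ^ 2)) /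
      ∑ j, Real.exp (-sqnorm (B.mulVec (x - Real.sqrt α • x0 j)) / (2 * σ ^ 2)))

/-- The per-pixel empirical risk `E_{i ~ Unif([N]), ε ~ N(0,I)} |g(√α x₀ⁱ + σε) − (x₀ⁱ)^q|²`. -/
noncomputable def pixelRisk {d N : ℕ} (x0 : Fin N → Fin d → ℝ) (α σ : ℝ)
    (q : Fin d) (g : (Fin d → ℝ) → ℝ) : ℝ≥0∞ :=
  (N : ℝ≥0∞)⁻¹ * ∑ i, ∫⁻ e, ENNReal.ofReal
    ((g (Real.sqrt α • x0 i + σ • e) - x0 i q) ^ 2) ∂(stdGaussian d)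

theorem lintegral_pi_fin_prod_eq_prod {n : ℕ} (μ : Fin n → Measure ℝ) [∀ i, SigmaFinite (μ i)]
    (f : Fin n → ℝ → ℝ≥0∞) (hf : ∀ i, Measurable (f i)) :
    ∫⁻ x, ∏ i, f i (x i) ∂(Measure.pi μ) = ∏ i, ∫⁻ x, f i x ∂(μ i) := by
  induction n with
  | zero => simp
  | succ n ih =>
    have hprod : Measurable fun x : Fin n → ℝ => ∏ i : Fin n, f i.succ (x i) :=
      Finset.measurable_prod _ fun i _ => (hf i.succ).comp (measurable_pi_apply i)
    calc ∫⁻ x, ∏ i, f i (x i) ∂(Measure.pi μ)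
        = ∫⁻ x, f 0 x.1 * ∏ i : Fin n, f i.succ (x.2 i)
            ∂((μ 0).prod (Measure.pi fun i => μ i.succ)) := by
          have h := (measurePreserving_piFinSuccAbove μ 0).lintegral_comp_emb
            (MeasurableEquiv.measurableEmbedding _)
            (fun x => f 0 x.1 * ∏ i : Fin n, f i.succ (x.2 i))
          simp only [Fin.zero_succAbove] at h
          rw [← h]
          refine lintegral_congr fun x => ?_
          rw [Fin.prod_univ_succ]
          rfl
      _ = ∏ i, ∫⁻ x, f i x ∂(μ i) := by
          rw [lintegral_prod_mul (hf 0).aemeasurable hprod.aemeasurable,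
            ih _ _ fun i => hf i.succ, Fin.prod_univ_succ]

theorem pi_withDensity_eq_withDensity_prod {n : ℕ} (μ : Fin n → Measure ℝ)
    [∀ i, SigmaFinite (μ i)] (f : Fin n → ℝ → ℝ≥0∞) (hf : ∀ i, Measurable (f i))
    [∀ i, SigmaFinite ((μ i).withDensity (f i))] :
    Measure.pi (fun i => (μ i).withDensity (f i)) =
      (Measure.pi μ).withDensity fun x => ∏ i, f i (x i) := by
  refine Measure.pi_eq fun s hs => ?_
  rw [withDensity_apply _ (MeasurableSet.univ_pi hs), Measure.restrict_pi_pi,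
    lintegral_pi_fin_prod_eq_prod _ f hf]
  exact Finset.prod_congr rfl fun i _ => (withDensity_apply _ (hs i)).symm

theorem lintegral_stdGaussian_affine {d : ℕ} (m : Fin d → ℝ) {σ : ℝ} (hσ : σ ≠ 0)
    {G : (Fin d → ℝ) → ℝ≥0∞} (hG : Measurable G) :
    ∫⁻ e, G (m + σ • e) ∂(_root_.stdGaussian d) =
      ∫⁻ x, (∏ k, gaussianPDF (m k) (.mk (σ ^ 2) (sq_nonneg σ)) (x k)) * G x := by
  set v : NNReal := .mk (σ ^ 2) (sq_nonneg σ) with hv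
  have hv0 : v ≠ 0 := by
    rw [← NNReal.coe_ne_zero]
    exact pow_ne_zero 2 hσ
  have hone : ∀ k, (gaussianReal 0 1).map (fun t => m k + σ * t) = gaussianReal (m k) v := by
    intro k
    have h : (fun t => m k + σ * t) = (fun t => m k + t) ∘ fun t => σ * t := rfl
    rw [h, ← Measure.map_map (by fun_prop) (by fun_prop), gaussianReal_map_const_mul,
      gaussianReal_map_const_add]
    simp [hv]
  have hmap : (_root_.stdGaussian d).map (fun e => m + σ • e) =
      volume.withDensity fun x => ∏ k, gaussianPDF (m k) v (x k) := by
    have : ∀ k, SigmaFinite ((gaussianReal 0 1).map (fun t => m k + σ * t)) := by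
      intro k
      rw [hone]
      infer_instance
    have : ∀ k, SigmaFinite ((volume : Measure ℝ).withDensity (gaussianPDF (m k) v)) := by
      intro k
      rw [← gaussianReal_of_var_ne_zero _ hv0]
      infer_instance
    have h := Measure.pi_map_pi (μ := fun _ : Fin d => gaussianReal 0 1)
      (f := fun k t => m k + σ * t) fun k => by fun_prop
    simp only [hone, gaussianReal_of_var_ne_zero _ hv0] at h
    rw [pi_withDensity_eq_withDensity_prod _ _ fun k => measurable_gaussianPDF _ _] at h
    rw [volume_pi, ← h, _root_.stdGaussian, gaussianReal_of_var_ne_zero _ one_ne_zero]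
    rfl
  have hdens : Measurable fun x : Fin d → ℝ => ∏ k, gaussianPDF (m k) v (x k) :=
    Finset.measurable_prod _ fun k _ => (measurable_gaussianPDF _ _).comp (measurable_pi_apply k)
  rw [← lintegral_map hG (by fun_prop), hmap, lintegral_withDensity_eq_lintegral_mul _ hdens hG]
  rfl

theorem sum_weighted_sq_sub_mean_le {ι : Type*} (s : Finset ι) (w y : ι → ℝ)
    (hW : 0 < ∑ i ∈ s, w i) (t : ℝ) :
    ∑ i ∈ s, w i * ((∑ j ∈ s, y j * (w j / ∑ l ∈ s, w l)) - y i) ^ 2 ≤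
      ∑ i ∈ s, w i * (t - y i) ^ 2 := by
  set c := ∑ j ∈ s, y j * (w j / ∑ l ∈ s, w l) with hc
  have hmean : ∑ i ∈ s, w i * y i = c * ∑ i ∈ s, w i := by
    rw [hc, Finset.sum_mul]
    refine Finset.sum_congr rfl fun i _ => ?_
    field_simp
  have hdiff : ∑ i ∈ s, w i * (t - y i) ^ 2 - ∑ i ∈ s, w i * (c - y i) ^ 2 =
      (t - c) ^ 2 * ∑ i ∈ s, w i := by
    have : ∑ i ∈ s, w i * (t - y i) ^ 2 - ∑ i ∈ s, w i * (c - y i) ^ 2 =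
        (t ^ 2 - c ^ 2) * ∑ i ∈ s, w i - 2 * (t - c) * ∑ i ∈ s, w i * y i := by
      simp only [Finset.mul_sum, ← Finset.sum_sub_distrib]
      exact Finset.sum_congr rfl fun i _ => by ring
    rw [this, hmean]
    ring
  nlinarith [mul_nonneg (sq_nonneg (t - c)) hW.le]

theorem binaryMask_mulVec_apply {d : ℕ} (a x : Fin d → ℝ) (k : Fin d) :
    (binaryMask a).mulVec x k = if a k = 0 then 0 else x k := by
  simp [binaryMask, Matrix.mulVec_diagonal]

theorem binaryMask_congr {d : ℕ} {a a' : Fin d → ℝ} (h : ∀ j, a j = 0 ↔ a' j = 0) :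
    binaryMask a' = binaryMask a := by
  simp only [binaryMask, h]

theorem diagonal_mulVec_eq_iff {d : ℕ} (a x y : Fin d → ℝ) :
    (Matrix.diagonal a).mulVec x = (Matrix.diagonal a).mulVec y ↔
      ∀ k, a k ≠ 0 → x k = y k := by
  simp only [funext_iff, Matrix.mulVec_diagonal, mul_eq_mul_left_iff]
  exact forall_congr' fun k => by tauto

theorem maskDenoiser_congr {d N : ℕ} (x0 : Fin N → Fin d → ℝ) (α σ : ℝ) (q : Fin d)
    {a x y : Fin d → ℝ} (h : ∀ k, a k ≠ 0 → x k = y k) :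
    maskDenoiser x0 α σ q (binaryMask a) x = maskDenoiser x0 α σ q (binaryMask a) y := by
  have hB : ∀ i, (binaryMask a).mulVec (x - √α • x0 i) =
      (binaryMask a).mulVec (y - √α • x0 i) := by
    intro i
    ext k
    by_cases hk : a k = 0
    · simp [binaryMask_mulVec_apply, hk]
    · simp [binaryMask_mulVec_apply, h k hk]
  simp only [maskDenoiser, hB]

theorem measurable_maskDenoiser {d N : ℕ} (x0 : Fin N → Fin d → ℝ) (α σ : ℝ) (q : Fin d)
    (a : Fin d → ℝ) : Measurable (maskDenoiser x0 α σ q (binaryMask a)) := by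
  have hE : ∀ i, Measurable fun x : Fin d → ℝ =>
      Real.exp (-sqnorm ((binaryMask a).mulVec (x - √α • x0 i)) / (2 * σ ^ 2)) := by
    intro i
    refine Continuous.measurable ?_
    unfold sqnorm
    fun_prop
  unfold maskDenoiser
  fun_prop

theorem prod_gaussianPDFReal_masked {d : ℕ} (a y : Fin d → ℝ) (σ : ℝ) (x : Fin d → ℝ) :
    ∏ k, gaussianPDFReal (if a k = 0 then 0 else y k) (.mk (σ ^ 2) (sq_nonneg σ)) (x k) =
      ((∏ _k : Fin d, (√(2 * π * σ ^ 2))⁻¹) *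
        Real.exp (∑ k, if a k = 0 then -(x k) ^ 2 / (2 * σ ^ 2) else 0)) *
      Real.exp (-sqnorm ((binaryMask a).mulVec (x - y)) / (2 * σ ^ 2)) := by
  simp only [gaussianPDFReal, Finset.prod_mul_distrib, NNReal.coe_mk, mul_assoc 2 π]
  rw [← Real.exp_sum, mul_assoc (Finset.prod _ _), ← Real.exp_add, sqnorm, ← Finset.sum_neg_distrib,
    Finset.sum_div, ← Finset.sum_add_distrib]
  congr 2
  refine Finset.sum_congr rfl fun k _ => ?_
  by_cases hk : a k = 0 <;> simp [binaryMask_mulVec_apply, hk]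

theorem pixelRisk_eq_lintegral {d N : ℕ} (x0 : Fin N → Fin d → ℝ) (α : ℝ) {σ : ℝ}
    (hσ : σ ≠ 0) (q : Fin d) (a : Fin d → ℝ) {g : (Fin d → ℝ) → ℝ} (hg : Measurable g)
    (hga : ∀ x y : Fin d → ℝ, (∀ k, a k ≠ 0 → x k = y k) → g x = g y) :
    pixelRisk x0 α σ q g = (N : ℝ≥0∞)⁻¹ * ∫⁻ x, ENNReal.ofReal
      (((∏ _k : Fin d, (√(2 * π * σ ^ 2))⁻¹) *
        Real.exp (∑ k, if a k = 0 then -(x k) ^ 2 / (2 * σ ^ 2) else 0)) *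
      ∑ i, Real.exp (-sqnorm ((binaryMask a).mulVec (x - √α • x0 i)) / (2 * σ ^ 2)) *
        (g x - x0 i q) ^ 2) := by
  have hG : ∀ i, Measurable fun x => ENNReal.ofReal ((g x - x0 i q) ^ 2) := fun i => by fun_prop
  have hterm : ∀ i, ∫⁻ e, ENNReal.ofReal ((g (√α • x0 i + σ • e) - x0 i q) ^ 2)
      ∂(_root_.stdGaussian d) =
      ∫⁻ x, (∏ k, gaussianPDF (if a k = 0 then 0 else (√α • x0 i) k)
        (.mk (σ ^ 2) (sq_nonneg σ)) (x k)) * ENNReal.ofReal ((g x - x0 i q) ^ 2) := by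
    intro i
    rw [← lintegral_stdGaussian_affine (fun k => if a k = 0 then 0 else (√α • x0 i) k) hσ (hG i)]
    refine lintegral_congr fun e => ?_
    rw [hga (√α • x0 i + σ • e) ((fun k => if a k = 0 then 0 else (√α • x0 i) k) + σ • e)
      fun k hk => by simp [hk]]
  simp only [pixelRisk, hterm]
  rw [← lintegral_finsetSum]
  · congr 1
    refine lintegral_congr fun x => ?_
    rw [Finset.mul_sum, ENNReal.ofReal_sum_of_nonneg fun i _ => by positivity]
    refine Finset.sum_congr rfl fun i _ => ?_
    simp only [gaussianPDF]
    rw [← ENNReal.ofReal_prod_of_nonneg fun k _ => gaussianPDFReal_nonneg _ _ _,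
      prod_gaussianPDFReal_masked, ← ENNReal.ofReal_mul (by positivity), mul_assoc]
  · intro i _
    exact (Finset.measurable_prod _ fun k _ =>
      (measurable_gaussianPDF _ _).comp (measurable_pi_apply k)).mul (hG i)

theorem diagonal_locality_optimal_denoiser_binarizes
    {d N : ℕ} (hN : 0 < N) (x0 : Fin N → Fin d → ℝ) (α σ : ℝ)
    (hα : α ∈ Set.Ioo (0 : ℝ) 1) (hσ : 0 < σ) (hσ2 : σ ^ 2 = 1 - α)
    (q : Fin d) (a : Fin d → ℝ) :
    -- `ĝ` (with the binary mask `B`) satisfies the constraint `g(x) = g(Ax)`-type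
    -- factorization through `A = diag(a)`
    (∀ x y : Fin d → ℝ,
        (Matrix.diagonal a).mulVec x = (Matrix.diagonal a).mulVec y →
        maskDenoiser x0 α σ q (binaryMask a) x = maskDenoiser x0 α σ q (binaryMask a) y)
    -- and it minimizes the per-pixel risk over all constrained measurable `g`
    ∧ (∀ g : (Fin d → ℝ) → ℝ, Measurable g →
        (∀ x y : Fin d → ℝ,
          (Matrix.diagonal a).mulVec x = (Matrix.diagonal a).mulVec y → g x = g y) →
        pixelRisk x0 α σ q (maskDenoiser x0 α σ q (binaryMask a))
          ≤ pixelRisk x0 α σ q g)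
    -- in particular the optimal denoiser depends only on the support of `a`,
    -- not on the nonzero values of `a`
    ∧ (∀ a' : Fin d → ℝ, (∀ j, a j = 0 ↔ a' j = 0) →
        maskDenoiser x0 α σ q (binaryMask a') = maskDenoiser x0 α σ q (binaryMask a)) := by
  simp only [diagonal_mulVec_eq_iff]
  refine ⟨fun x y h => maskDenoiser_congr x0 α σ q h, fun g hg hga => ?_,
    fun a' h => by rw [binaryMask_congr h]⟩
  rw [pixelRisk_eq_lintegral x0 α hσ.ne' q a hg hga,
    pixelRisk_eq_lintegral x0 α hσ.ne' q a (measurable_maskDenoiser x0 α σ q a)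
      fun x y h => maskDenoiser_congr x0 α σ q h]
  have : Nonempty (Fin N) := ⟨⟨0, hN⟩⟩
  refine mul_le_mul_of_nonneg_left (lintegral_mono fun x => ENNReal.ofReal_le_ofReal
    (mul_le_mul_of_nonneg_left ?_ (by positivity))) zero_le
  exact sum_weighted_sq_sub_mean_le Finset.univ
    (fun i => Real.exp (-sqnorm ((binaryMask a).mulVec (x - √α • x0 i)) / (2 * σ ^ 2)))
    (fun i => x0 i q)
    (Finset.sum_pos (fun i _ => Real.exp_pos _) Finset.univ_nonempty) (g x)
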